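/- Let T be a complete and deterministic transition relation over states X, uncontrollable inputs Inp, and nonempty controllable inputs C, and let P ⊆ X. If H ⊆ X satisfies H ⊆ P and H ⊆ Force¹ₛ(H), then every state of H is winning: for every x₀ ∈ H there exists a system implementation f : X × Inp → C such that every play under f with x 0 = x₀ satisfies x n ∈ P for all n. -/

import Mathlib

/-- If `H ⊆ P` and `H ⊆ Force¹ₛ(H)` (for a complete and deterministic
transition relation with nonempty controllable inputs), then every state of
`H` is winning: from every `x₀ ∈ H` there is a system implementation whose
plays starting at `x₀` visit only safe states. -/
theorem states_of_inductive_safe_set_are_winning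
    {X Inp C : Type*} [Nonempty Inp] [Nonempty C]
    (P : Set X) (T : X → Inp → C → X → Prop)
    (hcomplete : ∀ x i c, ∃ x', T x i c x')
    (hdet : ∀ x i c x₁' x₂', T x i c x₁' → T x i c x₂' → x₁' = x₂')
    (H : Set X) (hHP : H ⊆ P)
    (hforce : H ⊆ {x | ∀ i, ∃ c, ∃ x', T x i c x' ∧ x' ∈ H}) :
    ∀ x₀ ∈ H, ∃ f : X × Inp → C,
      ∀ x : ℕ → X,
        (∀ n, ∃ i, T (x n) i (f (x n, i)) (x (n + 1))) →
        x 0 = x₀ → ∀ n, x n ∈ P := by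
  intro x₀ hx₀
  have hchoice : ∀ p : X × Inp, ∃ c, p.1 ∈ H → ∃ x', T p.1 p.2 c x' ∧ x' ∈ H := by
    intro p
    by_cases hp : p.1 ∈ H
    · obtain ⟨c, hc⟩ := hforce hp p.2
      exact ⟨c, fun _ => hc⟩
    · exact ⟨Classical.arbitrary C, fun h => absurd h hp⟩
  choose f hf using hchoice
  refine ⟨f, fun x hplay hx n => hHP ?_⟩
  induction n with
  | zero => exact hx ▸ hx₀
  | succ n ih =>
    obtain ⟨i, hi⟩ := hplay n
    obtain ⟨x', hx', hx'H⟩ := hf (x n, i) ih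
    exact hdet _ _ _ _ _ hx' hi ▸ hx'H
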